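/- arXiv:1202.3405 — 8 statements merged into one kernel-verified Lean document; each statement's English description precedes it below -/
import Mathlib

section
/- Let F be a field, let f and g be nonzero polynomials in F[z] with IsCoprime f g, and suppose p = natDegree f ≥ natDegree g. Let s and t be nonzero polynomials in F[x] with IsCoprime s t. Define α = ∑_{k=0}^{p} C (f.coeff k) * t^(p−k) * s^k and β = ∑_{k=0}^{p} C (g.coeff k) * t^(p−k) * s^k in F[x] (these are the polynomials f(s/t)·t^p and g(s/t)·t^p). Then IsCoprime α β. -/
open Polynomial

/-- The degree-`n` homogenization of `h`, evaluated at `(a, b)` with `b ≠ 0`, is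
`b ^ n * h (a / b)`. -/
theorem sum_coeff_mul_pow_mul_pow_eq {F K : Type*} [Field F] [Field K] (φ : F →+* K)
    (h : F[X]) {n : ℕ} (hn : h.natDegree ≤ n) (a : K) {b : K} (hb : b ≠ 0) :
    ∑ k ∈ Finset.range (n + 1), φ (h.coeff k) * b ^ (n - k) * a ^ k =
      b ^ n * h.eval₂ φ (a / b) := by
  rw [eval₂_eq_sum_range' φ (Nat.lt_succ_of_le hn), Finset.mul_sum]
  refine Finset.sum_congr rfl fun k hk => ?_
  have hkn : k ≤ n := Nat.lt_succ_iff.mp (Finset.mem_range.mp hk)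
  rw [div_pow, pow_sub₀ b hb hkn]
  field_simp

/-- The homogenizations of coprime polynomials `f`, `g` in degree `f.natDegree` have no common
projective zero. -/
theorem eq_zero_and_eq_zero_of_sum_coeff_mul_pow_mul_pow_eq_zero {F K : Type*} [Field F] [Field K]
    (φ : F →+* K) {f g : F[X]} (hf : f ≠ 0) (hfg : IsCoprime f g)
    (hdeg : g.natDegree ≤ f.natDegree) {a b : K}
    (hα : ∑ k ∈ Finset.range (f.natDegree + 1),
      φ (f.coeff k) * b ^ (f.natDegree - k) * a ^ k = 0)
    (hβ : ∑ k ∈ Finset.range (f.natDegree + 1),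
      φ (g.coeff k) * b ^ (f.natDegree - k) * a ^ k = 0) :
    a = 0 ∧ b = 0 := by
  by_cases hb : b = 0
  · subst hb
    rw [Finset.sum_range_succ, Finset.sum_eq_zero, zero_add] at hα
    · have hlead : φ f.leadingCoeff ≠ 0 := by simpa using hf
      simp only [Nat.sub_self, pow_zero, mul_one, coeff_natDegree, mul_eq_zero, hlead,
        false_or] at hα
      exact ⟨eq_zero_of_pow_eq_zero hα, rfl⟩
    · intro k hk
      have hk' : f.natDegree - k ≠ 0 := Nat.sub_ne_zero_of_lt (Finset.mem_range.mp hk)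
      simp [hk']
  · rw [sum_coeff_mul_pow_mul_pow_eq φ f le_rfl a hb] at hα
    rw [sum_coeff_mul_pow_mul_pow_eq φ g hdeg a hb] at hβ
    have hf0 := (mul_eq_zero.mp hα).resolve_left (pow_ne_zero _ hb)
    have hg0 := (mul_eq_zero.mp hβ).resolve_left (pow_ne_zero _ hb)
    obtain ⟨u, v, huv⟩ := hfg
    have := congrArg (eval₂ φ (a / b)) huv
    simp [eval₂_add, eval₂_mul, hf0, hg0] at this

theorem stmt0 {F : Type*} [Field F] (f g s t : Polynomial F)
    (hf : f ≠ 0) (hg : g ≠ 0) (hfg : IsCoprime f g)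
    (hdeg : g.natDegree ≤ f.natDegree)
    (hs : s ≠ 0) (ht : t ≠ 0) (hst : IsCoprime s t) :
    IsCoprime
      (∑ k ∈ Finset.range (f.natDegree + 1),
        Polynomial.C (f.coeff k) * t ^ (f.natDegree - k) * s ^ k)
      (∑ k ∈ Finset.range (f.natDegree + 1),
        Polynomial.C (g.coeff k) * t ^ (f.natDegree - k) * s ^ k) := by
  rw [← Ideal.isCoprime_span_singleton_iff, Ideal.isCoprime_iff_sup_eq]
  by_contra hne
  obtain ⟨M, hM, hle⟩ := Ideal.exists_le_maximal _ hne
  rw [sup_le_iff, Ideal.span_singleton_le_iff_mem, Ideal.span_singleton_le_iff_mem,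
    ← Ideal.Quotient.eq_zero_iff_mem, ← Ideal.Quotient.eq_zero_iff_mem] at hle
  letI := Ideal.Quotient.field M
  simp only [map_sum, map_mul, map_pow] at hle
  obtain ⟨hs0, ht0⟩ := eq_zero_and_eq_zero_of_sum_coeff_mul_pow_mul_pow_eq_zero
    ((Ideal.Quotient.mk M).comp C) hf hfg hdeg hle.1 hle.2
  obtain ⟨u, v, huv⟩ := hst
  have := congrArg (Ideal.Quotient.mk M) huv
  simp [hs0, ht0] at this
end

section
/- Let F be a field and k : ℕ. Let f and g be nonzero polynomials in F[z] with IsCoprime f g, and let s and t be nonzero elements of MvPolynomial (Fin k) F such that every common divisor of s and t is a unit. Let d = max (natDegree f) (natDegree g), and define α = ∑_{j=0}^{d} C (f.coeff j) * s^j * t^(d−j) and β = ∑_{j=0}^{d} C (g.coeff j) * s^j * t^(d−j) in MvPolynomial (Fin k) F (these are the multivariate polynomials f(s/t)·t^d and g(s/t)·t^d). Then every common divisor of α and β in MvPolynomial (Fin k) F is a unit. -/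
open Polynomial in
/-- Evaluating the degree `n` homogenization of `p` at `(s, t)`. -/
theorem aeval_homogenize_eq_sum {R A : Type*} [CommSemiring R] [CommSemiring A] [Algebra R A]
    (p : R[X]) (n : ℕ) (s t : A) :
    MvPolynomial.aeval ![s, t] (p.homogenize n) =
      ∑ j ∈ Finset.range (n + 1), algebraMap R A (p.coeff j) * s ^ j * t ^ (n - j) := by
  rw [homogenize, map_sum, Finset.Nat.sum_antidiagonal_eq_sum_range_succ_mk]
  refine Finset.sum_congr rfl fun j _ => ?_
  simp [MvPolynomial.aeval_monomial, Finsupp.prod_fintype, mul_assoc]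

open Polynomial in
/-- A common divisor of homogenizations of coprime polynomials, evaluated at `(s, t)`, divides a
power of `t`. -/
theorem exists_dvd_pow_of_dvd_sum_of_isCoprime {R A : Type*} [CommRing R] [CommRing A]
    [Algebra R A] {f g : R[X]} (hfg : IsCoprime f g) {n : ℕ} (hf : f.natDegree ≤ n)
    (hg : g.natDegree ≤ n) {s t d : A}
    (hdf : d ∣ ∑ j ∈ Finset.range (n + 1), algebraMap R A (f.coeff j) * s ^ j * t ^ (n - j))
    (hdg : d ∣ ∑ j ∈ Finset.range (n + 1), algebraMap R A (g.coeff j) * s ^ j * t ^ (n - j)) :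
    ∃ m : ℕ, d ∣ t ^ m := by
  rw [← aeval_homogenize_eq_sum] at hdf hdg
  obtain ⟨u, v, huv⟩ := hfg
  obtain ⟨e, hu, hv⟩ : ∃ e, u.natDegree ≤ e ∧ v.natDegree ≤ e :=
    ⟨_, le_max_left _ _, le_max_right _ _⟩
  have h := congrArg (fun p : R[X] => MvPolynomial.aeval ![s, t] (p.homogenize (e + n))) huv
  simp only [homogenize_add, homogenize_mul u f hu hf,
    homogenize_mul v g hv hg, homogenize_one, map_add, map_mul, map_pow,
    MvPolynomial.aeval_X, Matrix.cons_val_one, Matrix.cons_val_fin_one] at h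
  exact ⟨e + n, h ▸ dvd_add (hdf.mul_left _) (hdg.mul_left _)⟩

/-- Modulo a divisor of `t`, a form in `(s, t)` reduces to its leading term in `s`. -/
theorem dvd_leading_term_of_dvd_sum {A : Type*} [CommRing A] (a : ℕ → A) (n : ℕ) {s t p : A}
    (hpt : p ∣ t) (h : p ∣ ∑ j ∈ Finset.range (n + 1), a j * s ^ j * t ^ (n - j)) :
    p ∣ a n * s ^ n := by
  rw [Finset.sum_range_succ, Nat.sub_self, pow_zero, mul_one] at h
  refine (dvd_add_right (Finset.dvd_sum fun j hj => ?_)).mp h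
  have hj' := Finset.mem_range.mp hj
  exact (hpt.trans (dvd_pow_self t (by omega))).mul_left _

theorem stmt1 {F : Type*} [Field F] (k : ℕ) (f g : Polynomial F)
    (hf : f ≠ 0) (hg : g ≠ 0) (hfg : IsCoprime f g)
    (s t : MvPolynomial (Fin k) F) (hs : s ≠ 0) (ht : t ≠ 0)
    (hst : ∀ d : MvPolynomial (Fin k) F, d ∣ s → d ∣ t → IsUnit d) :
    ∀ d : MvPolynomial (Fin k) F,
      d ∣ (∑ j ∈ Finset.range (max f.natDegree g.natDegree + 1),
            MvPolynomial.C (f.coeff j) * s ^ j * t ^ (max f.natDegree g.natDegree - j)) →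
      d ∣ (∑ j ∈ Finset.range (max f.natDegree g.natDegree + 1),
            MvPolynomial.C (g.coeff j) * s ^ j * t ^ (max f.natDegree g.natDegree - j)) →
      IsUnit d := by
  intro d hdf hdg
  set n := max f.natDegree g.natDegree
  obtain ⟨m, hm⟩ : ∃ m : ℕ, d ∣ t ^ m :=
    exists_dvd_pow_of_dvd_sum_of_isCoprime hfg (le_max_left _ _) (le_max_right _ _) hdf hdg
  by_contra hd
  obtain ⟨p, hp, hpd⟩ := WfDvdMonoid.exists_irreducible_factor hd
    (ne_zero_of_dvd_ne_zero (pow_ne_zero m ht) hm)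
  have hpt : p ∣ t := hp.prime.dvd_of_dvd_pow (hpd.trans hm)
  have dvd_s {q : Polynomial F} (hq : q ≠ 0) (hqn : n = q.natDegree)
      (hdq : d ∣ ∑ j ∈ Finset.range (n + 1),
        MvPolynomial.C (q.coeff j) * s ^ j * t ^ (n - j)) : p ∣ s := by
    have h := dvd_leading_term_of_dvd_sum _ n hpt (hpd.trans hdq)
    have hu : IsUnit (MvPolynomial.C (q.coeff n) : MvPolynomial (Fin k) F) := by
      rw [hqn]
      exact (Polynomial.leadingCoeff_ne_zero.mpr hq).isUnit.map MvPolynomial.C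
    exact hp.prime.dvd_of_dvd_pow (hu.dvd_mul_left.mp h)
  have hps : p ∣ s := by
    rcases max_choice f.natDegree g.natDegree with h | h
    · exact dvd_s hf h hdf
    · exact dvd_s hg h hdg
  exact hp.not_isUnit (hst p hps hpt)
end

section
/- Let F be a field, k : ℕ, and let f, g ∈ MvPolynomial (Fin (k+1)) F with g ≠ 0. Then g divides f in MvPolynomial (Fin (k+1)) F if and only if for every i : Fin (k+1), Φ_i g divides Φ_i f in Polynomial (FractionField (MvPolynomial (Fin k) F)); that is, g divides f as a multivariate polynomial if and only if, for each variable y_i, g divides f when both are regarded as univariate polynomials in y_i with coefficients in the field of rational functions in the remaining k variables. -/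
/-- The ring homomorphism sending a multivariate polynomial in `k+1` variables to the
univariate polynomial in the variable `y_i` with coefficients in the field of rational
functions in the remaining `k` variables: first swap variable `i` with variable `0`,
then single out variable `0`, then embed the coefficients into the fraction field. -/
noncomputable def Phi (F : Type*) [Field F] (k : ℕ) (i : Fin (k + 1)) :
    MvPolynomial (Fin (k + 1)) F →+* Polynomial (FractionRing (MvPolynomial (Fin k) F)) :=
  (Polynomial.mapRingHom
      (algebraMap (MvPolynomial (Fin k) F) (FractionRing (MvPolynomial (Fin k) F)))).comp
    ((MvPolynomial.finSuccEquiv F k).toAlgHom.comp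
      (MvPolynomial.renameEquiv F (Equiv.swap i 0)).toAlgHom).toRingHom

/-- If `p` divides `q` over the fraction field, then `p` divides a nonzero constant multiple of `q`
over the base domain. -/
theorem Polynomial.exists_dvd_C_mul_of_map_dvd_map {R : Type*} (K : Type*) [CommRing R] [IsDomain R]
    [Field K] [Algebra R K] [IsFractionRing R K] {p q : Polynomial R}
    (h : p.map (algebraMap R K) ∣ q.map (algebraMap R K)) :
    ∃ b : R, b ≠ 0 ∧ p ∣ Polynomial.C b * q := by
  obtain ⟨s, hs⟩ := h
  obtain ⟨b, hb, hbs⟩ := IsLocalization.integerNormalization_spec (nonZeroDivisors R) s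
  refine ⟨b, nonZeroDivisors.ne_zero hb,
    IsLocalization.integerNormalization (nonZeroDivisors R) s, ?_⟩
  apply Polynomial.map_injective _ (IsFractionRing.injective R K)
  rw [Polynomial.map_mul, Polynomial.map_mul, hbs, hs, Polynomial.map_C, algebra_compatible_smul K,
    Polynomial.smul_eq_C_mul]
  ring

theorem MvPolynomial.isUnit_of_degreeOf_eq_zero {σ F : Type*} [Field F] {p : MvPolynomial σ F}
    (hp : p ≠ 0) (h : ∀ i, p.degreeOf i = 0) : IsUnit p := by
  have hC : p = MvPolynomial.C (p.coeff 0) := by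
    rw [← MvPolynomial.totalDegree_eq_zero_iff_eq_C, MvPolynomial.totalDegree_eq_zero_iff]
    intro m hm i
    exact Nat.le_zero.mp ((MvPolynomial.monomial_le_degreeOf i hm).trans (h i).le)
  rw [hC]
  refine (IsUnit.mk0 _ fun h0 => hp ?_).map MvPolynomial.C
  rw [hC, h0, map_zero]

theorem stmt2 {F : Type*} [Field F] (k : ℕ) (f g : MvPolynomial (Fin (k + 1)) F)
    (hg : g ≠ 0) :
    g ∣ f ↔ ∀ i : Fin (k + 1), Phi F k i g ∣ Phi F k i f := by
  refine ⟨fun h i => map_dvd (Phi F k i) h, fun h => ?_⟩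
  obtain ⟨g', f', c, hrel, rfl, rfl⟩ := UniqueFactorizationMonoid.exists_reduced_factors g hg f
  have hc : c ≠ 0 := left_ne_zero_of_mul hg
  have hg' : g' ≠ 0 := right_ne_zero_of_mul hg
  refine mul_dvd_mul_left c (MvPolynomial.isUnit_of_degreeOf_eq_zero hg' fun i => ?_).dvd
  let e := (MvPolynomial.renameEquiv F (Equiv.swap i 0)).trans (MvPolynomial.finSuccEquiv F k)
  obtain ⟨b, hb, hdvd⟩ := Polynomial.exists_dvd_C_mul_of_map_dvd_map
    (p := e (c * g')) (q := e (c * f')) (FractionRing (MvPolynomial (Fin k) F)) (h i)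
  have hdvd' : c * g' ∣ c * (e.symm (Polynomial.C b) * f') := by
    simpa [mul_left_comm] using map_dvd e.symm hdvd
  have hb' : e g' ∣ Polynomial.C b := by
    simpa using map_dvd e (hrel.dvd_of_dvd_mul_right ((mul_dvd_mul_iff_left hc).mp hdvd'))
  have hdeg : (e g').natDegree = 0 := by
    simpa using Polynomial.natDegree_le_of_dvd hb' (Polynomial.C_ne_zero.mpr hb)
  rw [← MvPolynomial.degreeOf_rename_of_injective (Equiv.swap i 0).injective i,
    Equiv.swap_apply_left, ← MvPolynomial.natDegree_finSuccEquiv]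
  exact hdeg
end

section
/- Let F be a field, k : ℕ, and let f, g ∈ MvPolynomial (Fin (k+1)) F both be nonzero. Then every common divisor of f and g in MvPolynomial (Fin (k+1)) F is a unit if and only if for every i : Fin (k+1) one has IsCoprime (Φ_i f) (Φ_i g) in Polynomial (FractionField (MvPolynomial (Fin k) F)); that is, f and g have gcd 1 as multivariate polynomials if and only if, for each variable y_i, they are coprime when regarded as univariate polynomials in y_i over the field of rational functions in the remaining k variables. -/
open Polynomial nonZeroDivisors in
/-- Relatively prime polynomials over a GCD domain become coprime over its field of fractions. -/
theorem Polynomial.isCoprime_map_of_isRelPrime {R K : Type*} [CommRing R] [IsDomain R]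
    [IsGCDMonoid R] [Field K] [Algebra R K] [IsFractionRing R K] {p q : R[X]} (hp : p ≠ 0)
    (h : IsRelPrime p q) : IsCoprime (p.map (algebraMap R K)) (q.map (algebraMap R K)) := by
  have := Classical.arbitrary (NormalizedGCDMonoid R)
  have hinj : Function.Injective (algebraMap R K) := IsFractionRing.injective R K
  rw [← isRelPrime_iff_isCoprime]
  intro d hdp hdq
  have hd : d ≠ 0 := ne_zero_of_dvd_ne_zero ((Polynomial.map_ne_zero_iff hinj).2 hp) hdp
  set r := (IsLocalization.integerNormalization R⁰ d).primPart
  have hr : r.IsPrimitive := isPrimitive_primPart _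
  have hrd : r.map (algebraMap R K) ∣ d := by
    obtain ⟨c, hc0, hc⟩ := IsLocalization.integerNormalization_spec R⁰ d
    have hcK : IsUnit (C (algebraMap R K c)) :=
      isUnit_C.2 (IsLocalization.map_units K (⟨c, hc0⟩ : R⁰))
    rw [← hcK.dvd_mul_left, ← Polynomial.algebraMap_apply, ← Algebra.smul_def, ← hc]
    exact Polynomial.map_dvd _ (primPart_dvd _)
  exact isUnit_or_eq_zero_of_isUnit_integerNormalization_primPart hd <|
    h (hr.dvd_of_fraction_map_dvd_fraction_map (hrd.trans hdp))
      (hr.dvd_of_fraction_map_dvd_fraction_map (hrd.trans hdq))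

theorem MvPolynomial.totalDegree_eq_zero_of_degreeOf_eq_zero {σ R : Type*} [CommSemiring R]
    {p : MvPolynomial σ R} (h : ∀ i, p.degreeOf i = 0) : p.totalDegree = 0 :=
  (MvPolynomial.totalDegree_eq_zero_iff _ p).2 fun _ hm i => Nat.le_zero.1 (h i ▸ monomial_le_degreeOf i hm)

theorem Phi_apply (F : Type*) [Field F] (k : ℕ) (i : Fin (k + 1))
    (p : MvPolynomial (Fin (k + 1)) F) :
    Phi F k i p = (MvPolynomial.finSuccEquiv F k
      (MvPolynomial.renameEquiv F (Equiv.swap i 0) p)).map (algebraMap _ _) :=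
  rfl

theorem natDegree_Phi (F : Type*) [Field F] (k : ℕ) (i : Fin (k + 1))
    (p : MvPolynomial (Fin (k + 1)) F) : (Phi F k i p).natDegree = p.degreeOf i := by
  rw [Phi_apply, Polynomial.natDegree_map_eq_of_injective (IsFractionRing.injective _ _),
    MvPolynomial.natDegree_finSuccEquiv, MvPolynomial.renameEquiv_apply,
    ← MvPolynomial.degreeOf_rename_of_injective (Equiv.swap i 0).injective i,
    Equiv.swap_apply_left]

theorem stmt3 {F : Type*} [Field F] (k : ℕ) (f g : MvPolynomial (Fin (k + 1)) F)
    (hf : f ≠ 0) (hg : g ≠ 0) :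
    (∀ d : MvPolynomial (Fin (k + 1)) F, d ∣ f → d ∣ g → IsUnit d) ↔
      ∀ i : Fin (k + 1), IsCoprime (Phi F k i f) (Phi F k i g) := by
  constructor
  · intro h i
    let e := (MvPolynomial.renameEquiv F (Equiv.swap i 0)).trans (MvPolynomial.finSuccEquiv F k)
    have hrel : IsRelPrime (e f) (e g) :=
      IsRelPrime.of_map e.symm fun d hdf hdg =>
        h d (by simpa using hdf) (by simpa using hdg)
    exact Polynomial.isCoprime_map_of_isRelPrime ((map_ne_zero_iff e e.injective).2 hf) hrel
  · intro h d hdf hdg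
    have hd : d ≠ 0 := ne_zero_of_dvd_ne_zero hf hdf
    have hdeg : d.totalDegree = 0 :=
      MvPolynomial.totalDegree_eq_zero_of_degreeOf_eq_zero fun i => by
        rw [← natDegree_Phi]
        exact Polynomial.natDegree_eq_zero_of_isUnit
          ((h i).isUnit_of_dvd' (map_dvd _ hdf) (map_dvd _ hdg))
    rw [MvPolynomial.totalDegree_eq_zero_iff_eq_C] at hdeg
    rw [hdeg] at hd ⊢
    exact (IsUnit.mk0 _ fun h0 => hd (by rw [h0, map_zero])).map MvPolynomial.C
end

section
/- Let F be a field and n : ℕ, and let C, D : Matrix (Fin (n+1)) (Fin n) F be matrices each of rank n (equivalently, each with linearly independent columns). Let M : Matrix (Fin (n+1)) (Fin n) (RatFunc F) be the matrix with entries M i j = RatFunc.X * algebraMap F (RatFunc F) (C i j) − algebraMap F (RatFunc F) (D i j), i.e. M = z·C − D regarded over the field F(z) of rational functions. Then the rank of M equals n. -/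
namespace Matrix

/-- A matrix over a field with full column rank has a left inverse. -/
theorem exists_left_inverse_of_rank_eq_card {K m n : Type*} [Field K] [Fintype m] [Fintype n]
    [DecidableEq n] {A : Matrix m n K} (hA : A.rank = Fintype.card n) :
    ∃ B : Matrix n m K, B * A = 1 := by
  classical
  rw [← vecMul_surjective_iff_exists_left_inverse]
  have htop : LinearMap.range Aᵀ.mulVecLin = ⊤ := by
    apply Submodule.eq_top_of_finrank_eq
    rw [Module.finrank_fintype_fun_eq_card, ← hA, ← rank_transpose]
    rfl
  intro v
  obtain ⟨w, hw⟩ := LinearMap.range_eq_top.mp htop v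
  exact ⟨w, by simpa [mulVec_transpose] using hw⟩

/-- The characteristic matrix is nonsingular over the field of rational functions. -/
theorem det_map_charmatrix_ne_zero {K n : Type*} [Field K] [Fintype n] [DecidableEq n]
    (A : Matrix n n K) :
    ((charmatrix A).map (algebraMap (Polynomial K) (RatFunc K))).det ≠ 0 := by
  rw [← RingHom.mapMatrix_apply, ← RingHom.map_det]
  exact (map_ne_zero_iff _ (RatFunc.algebraMap_injective K)).mpr (charpoly_monic A).ne_zero

/-- The pencil `z • A - B` has full column rank over `K(z)` as soon as `A` does over `K`. -/
theorem rank_pencil_of_rank_eq_card {K m n : Type*} [Field K] [Fintype m] [Fintype n]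
    {A : Matrix m n K} (B : Matrix m n K) (hA : A.rank = Fintype.card n) :
    ((RatFunc.X : RatFunc K) • A.map (algebraMap K (RatFunc K))
      - B.map (algebraMap K (RatFunc K))).rank = Fintype.card n := by
  classical
  obtain ⟨L, hL⟩ := exists_left_inverse_of_rank_eq_card hA
  refine le_antisymm (rank_le_card_width _) ?_
  have hmul : L.map (algebraMap K (RatFunc K)) *
      ((RatFunc.X : RatFunc K) • A.map (algebraMap K (RatFunc K))
        - B.map (algebraMap K (RatFunc K))) =
      (charmatrix (L * B)).map (algebraMap (Polynomial K) (RatFunc K)) := by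
    rw [Matrix.mul_sub, Matrix.mul_smul, ← Matrix.map_mul, ← Matrix.map_mul, hL]
    ext i j
    by_cases hij : i = j
    · subst hij
      simp [RatFunc.algebraMap_eq_C, -Matrix.map_mul]
    · simp [hij, RatFunc.algebraMap_eq_C, -Matrix.map_mul]
  rw [← rank_of_det_ne_zero (det_map_charmatrix_ne_zero (L * B)), ← hmul]
  exact rank_mul_le_right _ _

end Matrix

theorem stmt6 {F : Type*} [Field F] (n : ℕ)
    (C D : Matrix (Fin (n + 1)) (Fin n) F)
    (hC : C.rank = n) (hD : D.rank = n) :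
    Matrix.rank
      (Matrix.of fun (i : Fin (n + 1)) (j : Fin n) =>
        RatFunc.X * algebraMap F (RatFunc F) (C i j)
          - algebraMap F (RatFunc F) (D i j)) = n :=
  (Matrix.rank_pencil_of_rank_eq_card D (hC.trans (Fintype.card_fin n).symm)).trans
    (Fintype.card_fin n)
end

section
/- Let F be a field and n : ℕ, and let C, D : Matrix (Fin (n+1)) (Fin n) F be matrices each of rank n. Let M : Matrix (Fin (n+1)) (Fin n) (Polynomial F) be the matrix with entries M i j = Polynomial.X * Polynomial.C (C i j) − Polynomial.C (D i j). Then there exists a vector r : Fin (n+1) → Polynomial F with r ≠ 0, natDegree (r i) ≤ n for every i, and Matrix.vecMul r M = 0; that is, the equation r(z)·(z·C − D) = 0 has a nonzero solution whose entries are polynomials in z of degree at most n. -/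
open Polynomial in
/-- A matrix of polynomials of degree at most `1` with one more row than columns has a nonzero
left kernel vector of degree at most the number of columns, by counting dimensions. -/
theorem exists_vecMul_eq_zero_of_natDegree_le_one {F : Type*} [Field F] (n : ℕ)
    (M : Matrix (Fin (n + 1)) (Fin n) F[X]) (hM : ∀ i j, (M i j).natDegree ≤ 1) :
    ∃ r : Fin (n + 1) → F[X], r ≠ 0 ∧ (∀ i, (r i).natDegree ≤ n) ∧ Matrix.vecMul r M = 0 := by
  let φ : (Fin (n + 1) → degreeLT F (n + 1)) →ₗ[F] Fin n → Fin (n + 2) → F :=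
    { toFun := fun r j k => (Matrix.vecMul (fun i => (r i : F[X])) M j).coeff k
      map_add' := fun r s => by
        ext j k
        simp [Matrix.vecMul, dotProduct, add_mul, Finset.sum_add_distrib]
      map_smul' := fun c r => by
        ext j k
        simp [Matrix.vecMul, dotProduct, Finset.mul_sum] }
  have : Module.Finite F (degreeLT F (n + 1)) :=
    Module.Finite.equiv (degreeLTEquiv F (n + 1)).symm
  have hlt : Module.finrank F (Fin n → Fin (n + 2) → F) <
      Module.finrank F (Fin (n + 1) → degreeLT F (n + 1)) := by
    simp only [Module.finrank_pi_fintype, (degreeLTEquiv F (n + 1)).finrank_eq,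
      Module.finrank_self, Finset.sum_const, Finset.card_univ, Fintype.card_fin, smul_eq_mul]
    nlinarith
  obtain ⟨r, hr, hr0⟩ := (Submodule.ne_bot_iff _).1 (φ.ker_ne_bot_of_finrank_lt hlt)
  have hdeg : ∀ i, (r i : F[X]).natDegree ≤ n := fun i =>
    natDegree_le_iff_coeff_eq_zero.2 fun k hk => coeff_eq_zero_of_degree_lt <|
      (mem_degreeLT.1 (r i).2).trans_le (by exact_mod_cast hk)
  refine ⟨fun i => r i, fun h => hr0 ?_, hdeg, ?_⟩
  · ext1 i
    exact Subtype.ext (congrFun h i)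
  · ext j k
    rcases lt_or_ge k (n + 2) with hk | hk
    · exact congrFun (congrFun (LinearMap.mem_ker.1 hr) j) ⟨k, hk⟩
    · refine coeff_eq_zero_of_natDegree_lt (lt_of_le_of_lt ?_ hk)
      rw [Matrix.vecMul, dotProduct]
      exact natDegree_sum_le_of_forall_le _ _ fun i _ =>
        natDegree_mul_le_of_le (hdeg i) (hM i j)

theorem stmt7 {F : Type*} [Field F] (n : ℕ)
    (C D : Matrix (Fin (n + 1)) (Fin n) F)
    (hC : C.rank = n) (hD : D.rank = n) :
    ∃ r : Fin (n + 1) → Polynomial F, r ≠ 0 ∧ (∀ i, (r i).natDegree ≤ n) ∧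
      Matrix.vecMul r
        (Matrix.of fun (i : Fin (n + 1)) (j : Fin n) =>
          Polynomial.X * Polynomial.C (C i j) - Polynomial.C (D i j)) = 0 := by
  refine exists_vecMul_eq_zero_of_natDegree_le_one n _ fun i j => ?_
  rw [Matrix.of_apply]
  compute_degree
end

section
/- Let K be a field and n : ℕ. Let η, c : Fin (2n+1) → K, and let f, g ∈ Polynomial K with natDegree f ≤ n, g ≠ 0, natDegree g < n, and g.eval (η j) ≠ 0 for every j. Let F : Matrix (Fin (n+1)) (Fin (n+1)) K with IsUnit F.det, and let C : Matrix (Fin (n+1)) (Fin n) K be such that the last row of F*C vanishes ((F*C) (Fin.last n) k = 0 for all k) and the top n×n block H of F*C, defined by H i k = (F*C) (Fin.castSucc i) k, satisfies IsUnit H.det. Define V : Matrix (Fin (2n+1)) (Fin (n+1)) K by V j t = c j * ∑_{u : Fin (n+1)} (η j)^(u : ℕ) * F u t, and W : Matrix (Fin (2n+1)) (Fin n) K by W j k = (f.eval (η j) / g.eval (η j)) * ∑_{t : Fin (n+1)} V j t * C t k. Then the 2n+1 columns of the juxtaposed matrix (V | W) are linearly dependent: there exist a : Fin (n+1) → K and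 b : Fin n → K, not both zero, such that Matrix.mulVec V a = Matrix.mulVec W b. (This is the key step showing that if p_i(x) = f(η(x))/g(η(x)) with deg f ≤ n and deg g ≤ n−1, then the decoding condition det(V₁ P_i V₁ C) ≠ 0 fails for every aligned precoding matrix V₁.) -/
/-- A vector with `p.coeff` as entries pairs with the powers of `x` to give `p.eval x`. -/
theorem sum_pow_mul_coeff_eq_eval {K : Type*} [CommSemiring K] {m : ℕ} {p : Polynomial K}
    (hp : p.natDegree < m) (x : K) :
    ∑ u : Fin m, x ^ (u : ℕ) * p.coeff u = p.eval x := by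
  rw [Polynomial.eval_eq_sum_range' hp, Finset.sum_range]
  exact Finset.sum_congr rfl fun u _ => mul_comm _ _

/-- A square matrix with invertible determinant maps onto every vector. -/
theorem exists_mulVec_eq_of_isUnit_det {K ι : Type*} [CommRing K] [Fintype ι] [DecidableEq ι]
    {M : Matrix ι ι K} (hM : IsUnit M.det) (v : ι → K) : ∃ w, M.mulVec w = v :=
  ⟨M⁻¹.mulVec v, by rw [Matrix.mulVec_mulVec, Matrix.mul_nonsing_inv M hM, Matrix.one_mulVec]⟩

theorem stmt10 {K : Type*} [Field K] (n : ℕ)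
    (η c : Fin (2 * n + 1) → K)
    (f g : Polynomial K)
    (hfdeg : f.natDegree ≤ n) (hg : g ≠ 0) (hgdeg : g.natDegree < n)
    (hgev : ∀ j, g.eval (η j) ≠ 0)
    (F : Matrix (Fin (n + 1)) (Fin (n + 1)) K) (hF : IsUnit F.det)
    (C : Matrix (Fin (n + 1)) (Fin n) K)
    (hlast : ∀ k : Fin n, (F * C) (Fin.last n) k = 0)
    (hH : IsUnit (Matrix.det
      (Matrix.of fun (i : Fin n) (k : Fin n) => (F * C) (Fin.castSucc i) k))) :
    ∃ (a : Fin (n + 1) → K) (b : Fin n → K), (a ≠ 0 ∨ b ≠ 0) ∧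
      Matrix.mulVec
        (Matrix.of fun (j : Fin (2 * n + 1)) (t : Fin (n + 1)) =>
          c j * ∑ u : Fin (n + 1), (η j) ^ (u : ℕ) * F u t) a =
      Matrix.mulVec
        (Matrix.of fun (j : Fin (2 * n + 1)) (k : Fin n) =>
          (f.eval (η j) / g.eval (η j)) *
            ∑ t : Fin (n + 1),
              (c j * ∑ u : Fin (n + 1), (η j) ^ (u : ℕ) * F u t) * C t k) b := by
  obtain ⟨a, ha⟩ := exists_mulVec_eq_of_isUnit_det hF fun u => f.coeff u
  obtain ⟨b, hb⟩ := exists_mulVec_eq_of_isUnit_det hH fun u => g.coeff u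
  have hFCb : (F * C).mulVec b = fun u : Fin (n + 1) => g.coeff u := by
    funext u
    refine Fin.lastCases ?_ (fun i => ?_) u
    · simp [Matrix.mulVec, dotProduct, hlast, Polynomial.coeff_eq_zero_of_natDegree_lt hgdeg]
    · exact congrFun hb i
  have hV : ∀ j t, ∑ u : Fin (n + 1), η j ^ (u : ℕ) * F u t =
      Matrix.vecMul (fun u : Fin (n + 1) => η j ^ (u : ℕ)) F t := fun _ _ => rfl
  refine ⟨a, b, Or.inr ?_, funext fun j => ?_⟩
  · rintro rfl
    refine hg (Polynomial.ext fun i => ?_)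
    rcases lt_or_ge i n with hi | hi
    · simpa using (congrFun hb ⟨i, hi⟩).symm
    · simpa using Polynomial.coeff_eq_zero_of_natDegree_lt (hgdeg.trans_le hi)
  · have hleft : dotProduct (Matrix.vecMul (fun u : Fin (n + 1) => η j ^ (u : ℕ)) F) a =
        f.eval (η j) := by
      rw [← Matrix.dotProduct_mulVec, ha]
      exact sum_pow_mul_coeff_eq_eval (Nat.lt_succ_of_le hfdeg) _
    have hright : dotProduct (Matrix.vecMul (Matrix.vecMul
        (fun u : Fin (n + 1) => η j ^ (u : ℕ)) F) C) b = g.eval (η j) := by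
      rw [Matrix.vecMul_vecMul, ← Matrix.dotProduct_mulVec, hFCb]
      exact sum_pow_mul_coeff_eq_eval (hgdeg.trans n.lt_succ_self) _
    calc
      _ = c j * dotProduct (Matrix.vecMul (fun u : Fin (n + 1) => η j ^ (u : ℕ)) F) a := by
        simp only [Matrix.mulVec, Matrix.of_apply, hV, dotProduct, Finset.mul_sum, mul_assoc]
      _ = f.eval (η j) / g.eval (η j) * (c j * dotProduct (Matrix.vecMul (Matrix.vecMul
          (fun u : Fin (n + 1) => η j ^ (u : ℕ)) F) C) b) := by
        rw [hleft, hright]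
        field_simp [hgev j]
      _ = _ := by
        simp only [Matrix.mulVec, Matrix.of_apply, hV, dotProduct, mul_assoc, ← Finset.mul_sum]
        rfl
end

section
/- Let F be a field. Let f and g be nonzero polynomials in F[z] with IsCoprime f g, and set d = max (natDegree f) (natDegree g). Let s and t be nonzero polynomials in F[x], and define α = ∑_{j=0}^{d} C (f.coeff j) * s^j * t^(d−j) and β = ∑_{j=0}^{d} C (g.coeff j) * s^j * t^(d−j) in F[x] (these are the polynomials f(s/t)·t^d and g(s/t)·t^d). If natDegree α = 1 and β is a nonzero constant (β ≠ 0 and natDegree β = 0), then d = 1. -/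
open Polynomial in
theorem natDegree_homogenized_term_le {F : Type*} [Field F] {s t : F[X]} {m d j : ℕ}
    (hs : s.natDegree ≤ m) (ht : t.natDegree ≤ m) (hj : j ≤ d) (c : F) :
    (C c * s ^ j * t ^ (d - j)).natDegree ≤ d * m := by
  have h₁ : (C c * s ^ j).natDegree ≤ j * m :=
    (natDegree_C_mul_le _ _).trans (natDegree_pow_le_of_le j hs)
  have h₂ : (t ^ (d - j)).natDegree ≤ (d - j) * m := natDegree_pow_le_of_le _ ht
  calc _ ≤ j * m + (d - j) * m := natDegree_mul_le_of_le h₁ h₂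
    _ = d * m := by rw [← add_mul, Nat.add_sub_cancel' hj]

open Polynomial in
theorem natDegree_homogenized_sum_le {F : Type*} [Field F] {s t : F[X]} {m : ℕ}
    (hs : s.natDegree ≤ m) (ht : t.natDegree ≤ m) (d : ℕ) (p : F[X]) :
    (∑ j ∈ Finset.range (d + 1), C (p.coeff j) * s ^ j * t ^ (d - j)).natDegree ≤ d * m :=
  natDegree_sum_le_of_forall_le _ _ fun _ hj =>
    natDegree_homogenized_term_le hs ht (Nat.lt_succ_iff.mp (Finset.mem_range.mp hj)) _

open Polynomial in
theorem coeff_homogenized_sum {F : Type*} [Field F] {s t : F[X]} {m : ℕ}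
    (hs : s.natDegree ≤ m) (ht : t.natDegree ≤ m) (d : ℕ) (p : F[X]) :
    (∑ j ∈ Finset.range (d + 1), C (p.coeff j) * s ^ j * t ^ (d - j)).coeff (d * m) =
      ∑ j ∈ Finset.range (d + 1), p.coeff j * s.coeff m ^ j * t.coeff m ^ (d - j) := by
  rw [finsetSum_coeff]
  refine Finset.sum_congr rfl fun j hj => ?_
  have hjd : j ≤ d := Nat.lt_succ_iff.mp (Finset.mem_range.mp hj)
  have hdm : d * m = j * m + (d - j) * m := by rw [← add_mul, Nat.add_sub_cancel' hjd]
  rw [hdm, mul_assoc, coeff_C_mul,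
    coeff_mul_add_eq_of_natDegree_le (natDegree_pow_le_of_le j hs)
      (natDegree_pow_le_of_le (d - j) ht),
    coeff_pow_of_natDegree_le hs, coeff_pow_of_natDegree_le ht, mul_assoc]

open Polynomial in
theorem sum_homogenized_eq_pow_mul_eval {F : Type*} [Field F] {p : F[X]} {d : ℕ}
    (hp : p.natDegree ≤ d) (a : F) {b : F} (hb : b ≠ 0) :
    ∑ j ∈ Finset.range (d + 1), p.coeff j * a ^ j * b ^ (d - j) = b ^ d * p.eval (a / b) := by
  rw [eval_eq_sum_range' (Nat.lt_succ_iff.mpr hp), Finset.mul_sum]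
  refine Finset.sum_congr rfl fun j hj => ?_
  have hjd : j ≤ d := Nat.lt_succ_iff.mp (Finset.mem_range.mp hj)
  rw [← Nat.sub_add_cancel hjd, pow_add, Nat.add_sub_cancel, div_pow]
  field_simp

open Polynomial in
theorem sum_homogenized_zero_right {F : Type*} [Field F] (p : F[X]) (d : ℕ) (a : F) :
    ∑ j ∈ Finset.range (d + 1), p.coeff j * a ^ j * (0 : F) ^ (d - j) = p.coeff d * a ^ d := by
  rw [Finset.sum_range_succ, Finset.sum_eq_zero]
  · simp
  · intro j hj
    rw [zero_pow (Nat.sub_ne_zero_of_lt (Finset.mem_range.mp hj)), mul_zero]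

open Polynomial in
/-- The homogenizations of two coprime polynomials to their maximal degree have no common
projective zero. -/
theorem eq_zero_of_homogenized_eq_zero {F : Type*} [Field F] {f g : F[X]}
    (hf : f ≠ 0) (hg : g ≠ 0) (hfg : IsCoprime f g) {d : ℕ}
    (hd : max f.natDegree g.natDegree = d) {a b : F}
    (hfab : ∑ j ∈ Finset.range (d + 1), f.coeff j * a ^ j * b ^ (d - j) = 0)
    (hgab : ∑ j ∈ Finset.range (d + 1), g.coeff j * a ^ j * b ^ (d - j) = 0) :
    a = 0 ∧ b = 0 := by
  by_cases hb : b = 0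
  · refine ⟨?_, hb⟩
    subst hb
    rw [sum_homogenized_zero_right] at hfab hgab
    by_contra ha
    have hfd := (mul_eq_zero.mp hfab).resolve_right (pow_ne_zero _ ha)
    have hgd := (mul_eq_zero.mp hgab).resolve_right (pow_ne_zero _ ha)
    rcases max_choice f.natDegree g.natDegree with h | h
    · rw [← hd, h] at hfd
      exact hf (leadingCoeff_eq_zero.mp hfd)
    · rw [← hd, h] at hgd
      exact hg (leadingCoeff_eq_zero.mp hgd)
  · rw [sum_homogenized_eq_pow_mul_eval (hd ▸ le_max_left _ _) a hb] at hfab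
    rw [sum_homogenized_eq_pow_mul_eval (hd ▸ le_max_right _ _) a hb] at hgab
    have hfe := (mul_eq_zero.mp hfab).resolve_left (pow_ne_zero _ hb)
    have hge := (mul_eq_zero.mp hgab).resolve_left (pow_ne_zero _ hb)
    obtain ⟨u, v, huv⟩ := hfg
    have h := congrArg (Polynomial.eval (a / b)) huv
    simp [hfe, hge] at h

theorem stmt11 {F : Type*} [Field F] (f g s t : Polynomial F)
    (hf : f ≠ 0) (hg : g ≠ 0) (hfg : IsCoprime f g)
    (hs : s ≠ 0) (ht : t ≠ 0)
    (hα : (∑ j ∈ Finset.range (max f.natDegree g.natDegree + 1),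
        Polynomial.C (f.coeff j) * s ^ j * t ^ (max f.natDegree g.natDegree - j)).natDegree = 1)
    (hβ0 : (∑ j ∈ Finset.range (max f.natDegree g.natDegree + 1),
        Polynomial.C (g.coeff j) * s ^ j * t ^ (max f.natDegree g.natDegree - j)) ≠ 0)
    (hβdeg : (∑ j ∈ Finset.range (max f.natDegree g.natDegree + 1),
        Polynomial.C (g.coeff j) * s ^ j * t ^ (max f.natDegree g.natDegree - j)).natDegree = 0) :
    max f.natDegree g.natDegree = 1 := by
  generalize hd : max f.natDegree g.natDegree = d at *
  obtain ⟨m, hm⟩ : ∃ m, max s.natDegree t.natDegree = m := ⟨_, rfl⟩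
  have hsm : s.natDegree ≤ m := hm ▸ le_max_left _ _
  have htm : t.natDegree ≤ m := hm ▸ le_max_right _ _
  have hle := natDegree_homogenized_sum_le hsm htm d f
  rw [hα] at hle
  suffices h : d * m ≤ 1 from Nat.eq_one_of_mul_eq_one_right (le_antisymm h hle)
  by_contra! hlt
  have hfc := Polynomial.coeff_eq_zero_of_natDegree_lt (hα.trans_lt hlt)
  have hgc := Polynomial.coeff_eq_zero_of_natDegree_lt (hβdeg.trans_lt hle)
  rw [coeff_homogenized_sum hsm htm] at hfc hgc
  obtain ⟨ha, hb⟩ := eq_zero_of_homogenized_eq_zero hf hg hfg hd hfc hgc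
  rcases max_choice s.natDegree t.natDegree with h | h
  · rw [← hm, h] at ha
    exact hs (Polynomial.leadingCoeff_eq_zero.mp ha)
  · rw [← hm, h] at hb
    exact ht (Polynomial.leadingCoeff_eq_zero.mp hb)
end
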